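/- arXiv:2210.05455 — 2 statements merged into one kernel-verified Lean document; each statement's English description precedes it below -/
import Mathlib

section
/- Let D ⊊ C ⊆ {0,1}^n be extremal concept classes satisfying the cubical colour condition. If c is a maximal cube of C of dimension d_c that is not contained in D, then there exists a maximal cube c* of the complement class {0,1}^n ∖ D of dimension n − d_c such that c ∩ c* consists of a single vertex. -/
variable {n : ℕ}

/-- Coordinatewise intersection (Boolean product) of two vertices. -/
def interV {α : Type*} (v w : α → Bool) : α → Bool := fun i => v i && w i

/-- A class is intersection closed if it is closed under coordinatewise products. -/
def IntersectionClosed {α : Type*} (C : Set (α → Bool)) : Prop :=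
  ∀ v ∈ C, ∀ w ∈ C, interV v w ∈ C

/-- The intersection closure: all iterated intersections of nonempty finite subsets. -/
def interClosure {α : Type*} (C : Set (α → Bool)) : Set (α → Bool) :=
  {x | ∃ S : Finset (α → Bool), S.Nonempty ∧ ↑S ⊆ C ∧ x = fun i => S.inf fun u => u i}

/-- Coordinate projection to the coordinates in `J`. -/
def proj (J : Finset (Fin n)) (v : Fin n → Bool) : {i // i ∈ J} → Bool := fun j => v j.1

/-- `C` shatters `I` if the projection of `C` to `I` is the full cube. -/
def Shatters (C : Set (Fin n → Bool)) (I : Finset (Fin n)) : Prop :=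
  proj I '' C = Set.univ

/-- The VC dimension: the largest cardinality of a shattered set of coordinates. -/
noncomputable def VCdim (C : Set (Fin n → Bool)) : ℕ :=
  sSup {k | ∃ I : Finset (Fin n), I.card = k ∧ Shatters C I}

/-- A shortest path in `A` from `u` to `v`: a sequence of length `hammingDist u v`
starting at `u`, ending at `v`, with all vertices in `A` and consecutive vertices
at Hamming distance `1`. -/
def IsShortestPath (A : Set (Fin n → Bool)) (u v : Fin n → Bool)
    (seq : Fin (hammingDist u v + 1) → Fin n → Bool) : Prop :=
  seq 0 = u ∧ seq (Fin.last (hammingDist u v)) = v ∧ (∀ i, seq i ∈ A) ∧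
    ∀ i : Fin (hammingDist u v), hammingDist (seq i.castSucc) (seq i.succ) = 1

/-- A class is shortest-path closed if any two of its vertices are joined by a
shortest path inside the class. -/
def SPClosed (C : Set (Fin n → Bool)) : Prop :=
  ∀ u ∈ C, ∀ v ∈ C, ∃ seq, IsShortestPath C u v seq

/-- A cube with colour set `I` (and some anchor `a` outside `I`). -/
def IsCubeOn (I : Finset (Fin n)) (c : Set (Fin n → Bool)) : Prop :=
  ∃ a : Fin n → Bool, c = {v | ∀ i, i ∉ I → v i = a i}

/-- A cube (with some colour set). -/
def IsCube (c : Set (Fin n → Bool)) : Prop := ∃ I, IsCubeOn I c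

/-- `c` is a maximal cube of `A`: a cube contained in `A` not properly contained in
another cube contained in `A`. -/
def MaximalCubeIn (A c : Set (Fin n → Bool)) : Prop :=
  IsCube c ∧ c ⊆ A ∧ ∀ c', IsCube c' → c' ⊆ A → c ⊆ c' → c' = c

/-- A class is extremal if every shattered colour set is witnessed by a cube inside
the class. -/
def Extremal (C : Set (Fin n → Bool)) : Prop :=
  ∀ I : Finset (Fin n), Shatters C I → ∃ c, IsCubeOn I c ∧ c ⊆ C

/-- The cubical colour condition for the pair `(C, D)`: every cube contained in `C`
that is not maximal in `C` has a cube in `D` with the same colour set. -/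
def CCC (C D : Set (Fin n → Bool)) : Prop :=
  ∀ I c, IsCubeOn I c → c ⊆ C → ¬ MaximalCubeIn C c →
    ∃ c', IsCubeOn I c' ∧ c' ⊆ D

/-- `A` has an edge of colour `i`: two vertices of `A` differing exactly at `i`. -/
def HasEdge (A : Set (Fin n → Bool)) (i : Fin n) : Prop :=
  ∃ v ∈ A, ∃ w ∈ A, v i ≠ w i ∧ ∀ j, j ≠ i → v j = w j

/-- An unlabelled compression scheme of size `k` for `C`. -/
def HasCompression (C : Set (Fin n → Bool)) (k : ℕ) : Prop :=
  ∃ r : (Fin n → Bool) → Finset (Fin n),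
    Set.InjOn r C ∧ (∀ v ∈ C, (r v).card ≤ k) ∧
      ∀ v ∈ C, ∀ w ∈ C, v ≠ w → ∃ i ∈ r v ∪ r w, v i ≠ w i

/-- Coordinates where `v` is `1` but `w` is `0`. -/
def delta (v w : Fin n → Bool) : Finset (Fin n) :=
  Finset.univ.filter fun i => v i = true ∧ w i = false

/-- The vertex obtained from `v` by setting to `0` the `j` smallest (in the order
induced by the permutation `π`) coordinates of `delta v w`. -/
def stepVert (π : Equiv.Perm (Fin n)) (v w : Fin n → Bool) (j : ℕ) : Fin n → Bool :=
  fun i =>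
    if i ∈ delta v w ∧ ((delta v w).filter fun i' => π i' < π i).card < j then false
    else v i

/-- The shortest-path closure construction of `C` (with respect to the linear order
on coordinates induced by `π`). -/
def spClosure (π : Equiv.Perm (Fin n)) (C : Set (Fin n → Bool)) : Set (Fin n → Bool) :=
  {x | ∃ v ∈ C, ∃ w ∈ C, w ≤ v ∧ ∃ j ≤ (delta v w).card, x = stepVert π v w j}

/-- Coordinatewise XOR with `b` (a change of origin). -/
def xorShift (b : Fin n → Bool) (C : Set (Fin n → Bool)) : Set (Fin n → Bool) :=
  (fun v i => xor (v i) (b i)) '' C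

/-- The `k`-close cube condition. -/
def KCloseCube (C : Set (Fin n → Bool)) (k : ℕ) : Prop :=
  ∃ v : Fin n → Bool, ∀ J : Finset (Fin n), J.card = k + 1 →
    ∃ b : {i // i ∈ J} → Bool, hammingDist b (proj J v) ≤ 1 ∧ b ∉ proj J '' C

theorem Bool.eq_of_ne_of_ne {x y z : Bool} (hx : x ≠ z) (hy : y ≠ z) : x = y := by
  revert x y z
  decide

theorem shatters_iff {C : Set (Fin n → Bool)} {I : Finset (Fin n)} :
    Shatters C I ↔ ∀ b : Fin n → Bool, ∃ v ∈ C, ∀ i ∈ I, v i = b i := by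
  constructor
  · intro h b
    obtain ⟨v, hv, hvb⟩ : proj I b ∈ proj I '' C := by rw [h]; trivial
    exact ⟨v, hv, fun i hi => congrFun hvb ⟨i, hi⟩⟩
  · intro h
    refine Set.eq_univ_of_forall fun b => ?_
    obtain ⟨v, hv, hvb⟩ := h fun i => if hi : i ∈ I then b ⟨i, hi⟩ else false
    refine ⟨v, hv, funext fun j => ?_⟩
    simpa [proj] using hvb j.1 j.2

theorem shatters_of_cube_subset {C : Set (Fin n → Bool)} {I : Finset (Fin n)}
    {a : Fin n → Bool} (h : {v | ∀ i, i ∉ I → v i = a i} ⊆ C) : Shatters C I := by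
  refine shatters_iff.2 fun b => ⟨I.piecewise b a, h fun i hi => ?_, fun i hi => ?_⟩
  · simp [hi]
  · simp [hi]

/-- An extremal class remains extremal when restricted to a facet of the Boolean cube. -/
theorem Extremal.inter_facet {C : Set (Fin n → Bool)} (hC : Extremal C) (i : Fin n) (b : Bool) :
    Extremal (C ∩ {v | v i = b}) := by
  intro I hI
  rw [shatters_iff] at hI
  have hiI : i ∉ I := by
    intro hi
    obtain ⟨v, ⟨-, hv⟩, hvb⟩ := hI fun _ => !b
    have := hvb i hi
    simp_all
  by_cases hs : Shatters C (insert i I)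
  · obtain ⟨_, ⟨a, rfl⟩, hc⟩ := hC _ hs
    refine ⟨_, ⟨Function.update a i b, rfl⟩, fun v hv => ⟨hc fun j hj => ?_, ?_⟩⟩
    · have hj' : j ≠ i ∧ j ∉ I := by simpa using hj
      simpa [hj'.1] using hv j hj'.2
    · simpa using hv i hiI
  · have hsI : Shatters C I :=
      shatters_iff.2 fun x => (hI x).imp fun v hv => ⟨hv.1.1, hv.2⟩
    obtain ⟨_, ⟨a, rfl⟩, hc⟩ := hC _ hsI
    refine ⟨_, ⟨a, rfl⟩, fun v hv => ⟨hc hv, ?_⟩⟩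
    by_contra hvi
    refine hs (shatters_iff.2 fun x => ?_)
    by_cases hx : x i = b
    · obtain ⟨w, hw, hwx⟩ := hI x
      refine ⟨w, hw.1, fun j hj => ?_⟩
      rcases Finset.mem_insert.1 hj with rfl | hj
      · exact hw.2.trans hx.symm
      · exact hwx j hj
    · refine ⟨I.piecewise x a, hc fun j hj => by simp [hj], fun j hj => ?_⟩
      rcases Finset.mem_insert.1 hj with rfl | hj
      · have h1 : v j = a j := hv j hiI
        have h2 : ¬ v j = b := hvi
        rw [Finset.piecewise_eq_of_notMem _ _ _ hiI, ← h1]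
        exact Bool.eq_of_ne_of_ne h2 hx
      · simp [hj]

/-- An extremal class remains extremal when restricted to a face of the Boolean cube. -/
theorem Extremal.inter_face {C : Set (Fin n → Bool)} (hC : Extremal C) (a : Fin n → Bool)
    (S : Finset (Fin n)) : Extremal (C ∩ {v | ∀ i ∈ S, v i = a i}) := by
  induction S using Finset.induction_on with
  | empty => simpa using hC
  | insert j S _ ih =>
    convert ih.inter_facet j (a j) using 1
    ext v
    simp only [Finset.mem_insert, forall_eq_or_imp, Set.mem_inter_iff, Set.mem_ofPred_eq]
    tauto

/-- If an extremal class contains two different parallel cubes, then the first one extends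
to a cube of one dimension more inside the class. -/
theorem Extremal.exists_extension_of_parallel {C : Set (Fin n → Bool)} (hC : Extremal C)
    {I : Finset (Fin n)} {a : Fin n → Bool} (ha : {v | ∀ i, i ∉ I → v i = a i} ⊆ C)
    (a' : Fin n → Bool) (ha' : {v | ∀ i, i ∉ I → v i = a' i} ⊆ C)
    (hne : ∃ i, i ∉ I ∧ a i ≠ a' i) :
    ∃ j, j ∉ I ∧ {v | ∀ i, i ∉ insert j I → v i = a i} ⊆ C := by
  induction hk : (Finset.univ.filter fun i => i ∉ I ∧ a i ≠ a' i).card using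
    Nat.strong_induction_on generalizing a' with
  | _ k ih =>
  obtain ⟨j, hjI, hj⟩ := hne
  have hs : Shatters (C ∩ {v | ∀ i ∈ Finset.univ.filter (fun i => i ∉ I ∧ a i = a' i), v i = a i})
      (insert j I) := by
    refine shatters_iff.2 fun x => ?_
    by_cases hx : x j = a j
    · refine ⟨I.piecewise x a, ⟨ha fun i hi => by simp [hi], fun i hi => ?_⟩, fun i hi => ?_⟩
      · simp_all
      · rcases Finset.mem_insert.1 hi with rfl | hi
        · simp [hjI, hx]
        · simp [hi]
    · refine ⟨I.piecewise x a', ⟨ha' fun i hi => by simp [hi], fun i hi => ?_⟩, fun i hi => ?_⟩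
      · simp_all
      · rcases Finset.mem_insert.1 hi with rfl | hi
        · rw [Finset.piecewise_eq_of_notMem _ _ _ hjI]
          exact Bool.eq_of_ne_of_ne hj.symm hx
        · simp [hi]
  obtain ⟨_, ⟨e, rfl⟩, he⟩ := hC.inter_face a _ _ hs
  have hea : ∀ i, i ∉ I → a i = a' i → e i = a i := fun i hi hi' =>
    (he (a := e) fun _ _ => rfl).2 i (by simp [hi, hi'])
  by_cases hall : ∀ i, i ∉ insert j I → e i = a i
  · refine ⟨j, hjI, fun v hv => (he fun i hi => ?_).1⟩
    rw [hv i hi, hall i hi]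
  · push Not at hall
    obtain ⟨l, hl, hla⟩ := hall
    have hl' : l ≠ j ∧ l ∉ I := by simpa using hl
    refine ih _ ?_ (Function.update e j (a j)) (fun v hv => (he fun i hi => ?_).1)
      ⟨l, hl'.2, by simpa [hl'.1] using hla.symm⟩ rfl
    · rw [← hk]
      refine Finset.card_lt_card (Finset.ssubset_iff_of_subset (fun i hi => ?_) |>.2 ⟨j, ?_, ?_⟩)
      · simp only [Finset.mem_filter, Finset.mem_univ, true_and] at hi ⊢
        refine ⟨hi.1, fun h => hi.2 ?_⟩
        have hij : i ≠ j := fun hij => hj (hij ▸ h)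
        simp [hij, hea i hi.1 h]
      · simp [hjI, hj]
      · simp
    · have hij : i ≠ j ∧ i ∉ I := by simpa using hi
      simpa [hij.1] using hv i hij.2

/-- A maximal cube of an extremal class is the only cube of its colour set in the class. -/
theorem Extremal.eq_of_maximalCubeIn {C c d : Set (Fin n → Bool)} (hC : Extremal C)
    {I : Finset (Fin n)} (hc : IsCubeOn I c) (hmax : MaximalCubeIn C c) (hd : IsCubeOn I d)
    (hdC : d ⊆ C) : d = c := by
  obtain ⟨a, rfl⟩ := hc
  obtain ⟨a', rfl⟩ := hd
  by_cases hne : ∃ i, i ∉ I ∧ a i ≠ a' i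
  · obtain ⟨j, hj, hsub⟩ := hC.exists_extension_of_parallel hmax.2.1 a' hdC hne
    have heq := hmax.2.2 _ ⟨_, a, rfl⟩ hsub fun v hv i hi =>
      hv i fun h => hi (Finset.mem_insert_of_mem h)
    have hmem : Function.update a j (!a j) ∈ {v | ∀ i, i ∉ insert j I → v i = a i} := by
      intro i hi
      have hij : i ≠ j := fun h => hi (by simp [h])
      simp [hij]
    rw [heq] at hmem
    simpa using hmem j hj
  · push Not at hne
    ext v
    exact forall₂_congr fun i hi => by rw [hne i hi]

/-- For a proper pair `(C, D)` of extremal classes satisfying the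
cubical colour condition, every maximal cube `c` of `C` not contained in `D` has a
complementary maximal cube `c*` of the complement class `{0,1}ⁿ ∖ D`. -/
theorem exists_complementary_maximal_cube (C D : Set (Fin n → Bool))
    (hC : Extremal C) (hD : Extremal D) (hsub : D ⊂ C) (hccc : CCC C D)
    (c : Set (Fin n → Bool)) (I : Finset (Fin n)) (hcI : IsCubeOn I c)
    (hmax : MaximalCubeIn C c) (hnotD : ¬ c ⊆ D) :
    ∃ (I' : Finset (Fin n)) (c' : Set (Fin n → Bool)), IsCubeOn I' c' ∧
      MaximalCubeIn Dᶜ c' ∧ I.card + I'.card = n ∧ ∃ v, c ∩ c' = {v} := by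
  have hnI : ¬ Shatters D I := by
    intro h
    obtain ⟨d, hd, hdD⟩ := hD I h
    exact hnotD (hC.eq_of_maximalCubeIn hcI hmax hd (hdD.trans hsub.subset) ▸ hdD)
  have hsmall : ∀ i ∈ I, Shatters D (I.erase i) := by
    intro i hi
    obtain ⟨a, rfl⟩ := hcI
    have hss : {v : Fin n → Bool | ∀ j, j ∉ I.erase i → v j = a j} ⊆
        {v | ∀ j, j ∉ I → v j = a j} := fun v hv j hj => hv j (by simp [hj])
    obtain ⟨_, ⟨d, rfl⟩, hd⟩ := hccc (I.erase i) _ ⟨a, rfl⟩ (hss.trans hmax.2.1) fun hm => by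
      have heq := hm.2.2 _ hmax.1 hmax.2.1 hss
      have hmem : Function.update a i (!a i) ∈ {v | ∀ j, j ∉ I → v j = a j} := by
        intro j hj
        have hij : j ≠ i := fun h => hj (h ▸ hi)
        simp [hij]
      rw [heq] at hmem
      simpa using hmem i (by simp)
    exact shatters_of_cube_subset hd
  rw [shatters_iff] at hnI
  push Not at hnI
  obtain ⟨b, hb⟩ := hnI
  refine ⟨Iᶜ, {v | ∀ i, i ∉ Iᶜ → v i = b i}, ⟨b, rfl⟩, ⟨⟨_, b, rfl⟩, ?_, ?_⟩, ?_, ?_⟩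
  · intro v hv hvD
    obtain ⟨i, hi, hne⟩ := hb v hvD
    exact hne (hv i (by simpa using hi))
  · rintro _ ⟨K, e, rfl⟩ hsubD hle
    refine Set.Subset.antisymm (fun v hv i hi => ?_) hle
    have hiI : i ∈ I := by simpa using hi
    have hbe : ∀ x : Fin n → Bool, (∀ k ∈ I, x k = b k) → ∀ k, k ∉ K → x k = e k :=
      fun x hx => hle fun k hk => hx k (by simpa using hk)
    have hKI : ∀ k, k ∉ K → k ∈ I := by
      intro k hk
      by_contra hkI
      have := hbe (Function.update b k (!e k))
        (fun l hl => by simp [show l ≠ k from fun h => hkI (h ▸ hl)]) k hk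
      simp at this
    by_cases hiK : i ∈ K
    · obtain ⟨w, hwD, hw⟩ := shatters_iff.1 (hsmall i hiI) b
      refine absurd hwD (hsubD fun k hk => ?_)
      rw [hw k (Finset.mem_erase.2 ⟨fun h => hk (h ▸ hiK), hKI k hk⟩)]
      exact hbe b (fun _ _ => rfl) k hk
    · exact (hv i hiK).trans (hbe b (fun _ _ => rfl) i hiK).symm
  · simp
  · obtain ⟨a, rfl⟩ := hcI
    refine ⟨I.piecewise b a, Set.ext fun v => ?_⟩
    simp only [Set.mem_inter_iff, Set.mem_ofPred_eq, Finset.mem_compl, not_not,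
      Set.mem_singleton_iff]
    constructor
    · rintro ⟨h1, h2⟩
      funext i
      by_cases hi : i ∈ I
      · simp [hi, h2 i hi]
      · simp [hi, h1 i hi]
    · rintro rfl
      exact ⟨fun i hi => by simp [hi], fun i hi => by simp [hi]⟩
end

section
/- Let C ⊆ {0,1}^n be an extremal concept class of VC dimension d ≥ 1, and suppose C contains a maximum class D of VC dimension d − 1. Then C admits an unlabelled compression scheme of size d. -/
variable {n : ℕ}

namespace Finset

variable {α : Type*} [DecidableEq α]

/-- The deletion of `x` from `𝒜`, i.e. the projection forgetting the coordinate `x`. -/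
def deletion (x : α) (𝒜 : Finset (Finset α)) : Finset (Finset α) :=
  𝒜.memberSubfamily x ∪ 𝒜.nonMemberSubfamily x

/-- The link of `x` in `𝒜`, i.e. the reduction of `𝒜` along the coordinate `x`. -/
def edgeLink (x : α) (𝒜 : Finset (Finset α)) : Finset (Finset α) :=
  𝒜.memberSubfamily x ∩ 𝒜.nonMemberSubfamily x

/-- The cube with colour set `X` through `v` is contained in `𝒜`. -/
def HasCubeAt (𝒜 : Finset (Finset α)) (X v : Finset α) : Prop :=
  ∀ w : Finset α, (∀ i, i ∉ X → (i ∈ w ↔ i ∈ v)) → w ∈ 𝒜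

/-- Every shattered set is the colour set of a cube in the family. -/
def IsExtremal (𝒜 : Finset (Finset α)) : Prop :=
  ∀ I, 𝒜.Shatters I → ∃ v, 𝒜.HasCubeAt I v

/-- Maximum classes of VC dimension `d - 1` on the ground set `S`; for `d = 0` this is the
empty class. -/
structure IsMaximum (S : Finset α) (d : ℕ) (𝒜 : Finset (Finset α)) : Prop where
  subset : ∀ v ∈ 𝒜, v ⊆ S
  card_lt : ∀ I, 𝒜.Shatters I → #I < d
  card_eq : #𝒜 = ∑ i ∈ range d, (#S).choose i

/-- `X` is a `d`-set spanning a cube of `C` at `v` whose pattern on `X` is missed by `D`. -/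
structure IsLabel (C D : Finset (Finset α)) (d : ℕ) (X v : Finset α) : Prop where
  card_eq : #X = d
  cube : C.HasCubeAt X v
  missed : ∀ u ∈ D, ∃ i ∈ X, ¬ (i ∈ u ↔ i ∈ v)

variable {C D 𝒜 : Finset (Finset α)} {S X Y u v w : Finset α} {x : α} {d : ℕ}

lemma erase_mem_deletion : v.erase x ∈ deletion x 𝒜 ↔ v ∈ 𝒜 ∨ symmDiff v {x} ∈ 𝒜 := by
  simp only [deletion, mem_union, mem_memberSubfamily, mem_nonMemberSubfamily]
  by_cases h : x ∈ v
  · have h₁ : insert x (v.erase x) = v := insert_erase h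
    have h₂ : symmDiff v {x} = v.erase x := by ext i; simp [mem_symmDiff]; grind
    simp [h₁, h₂]
  · have h₁ : v.erase x = v := erase_eq_of_notMem h
    have h₂ : symmDiff v {x} = insert x v := by ext i; simp [mem_symmDiff]; grind
    simp [h₂, h, or_comm]

lemma erase_mem_edgeLink : v.erase x ∈ edgeLink x 𝒜 ↔ v ∈ 𝒜 ∧ symmDiff v {x} ∈ 𝒜 := by
  simp only [edgeLink, mem_inter, mem_memberSubfamily, mem_nonMemberSubfamily]
  by_cases h : x ∈ v
  · have h₁ : insert x (v.erase x) = v := insert_erase h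
    have h₂ : symmDiff v {x} = v.erase x := by ext i; simp [mem_symmDiff]; grind
    simp [h₁, h₂]
  · have h₁ : v.erase x = v := erase_eq_of_notMem h
    have h₂ : symmDiff v {x} = insert x v := by ext i; simp [mem_symmDiff]; grind
    simp [h₂, h, and_comm]

lemma notMem_of_mem_deletion (h : u ∈ deletion x 𝒜) : x ∉ u := by
  simp only [deletion, mem_union, mem_memberSubfamily, mem_nonMemberSubfamily] at h
  tauto

lemma notMem_of_mem_edgeLink (h : u ∈ edgeLink x 𝒜) : x ∉ u := by
  simp only [edgeLink, mem_inter, mem_memberSubfamily, mem_nonMemberSubfamily] at h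
  tauto

lemma exists_of_mem_deletion (h : u ∈ deletion x 𝒜) : ∃ v ∈ 𝒜, v.erase x = u := by
  have hx := notMem_of_mem_deletion h
  simp only [deletion, mem_union, mem_memberSubfamily, mem_nonMemberSubfamily] at h
  rcases h with h | h
  · exact ⟨_, h.1, erase_insert hx⟩
  · exact ⟨_, h.1, erase_eq_of_notMem hx⟩

lemma mem_edgeLink : u ∈ edgeLink x 𝒜 ↔ insert x u ∈ 𝒜 ∧ u ∈ 𝒜 ∧ x ∉ u := by
  simp only [edgeLink, mem_inter, mem_memberSubfamily, mem_nonMemberSubfamily]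
  tauto

lemma edgeLink_subset_deletion : edgeLink x 𝒜 ⊆ deletion x 𝒜 :=
  inter_subset_left.trans subset_union_left

lemma card_deletion_add_card_edgeLink (x : α) (𝒜 : Finset (Finset α)) :
    #(deletion x 𝒜) + #(edgeLink x 𝒜) = #𝒜 := by
  rw [deletion, edgeLink, card_union_add_card_inter,
    card_memberSubfamily_add_card_nonMemberSubfamily]

lemma deletion_mono (h : D ⊆ C) : deletion x D ⊆ deletion x C := by
  intro u hu
  obtain ⟨v, hv, rfl⟩ := exists_of_mem_deletion hu
  exact erase_mem_deletion.2 (.inl (h hv))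

lemma edgeLink_mono (h : D ⊆ C) : edgeLink x D ⊆ edgeLink x C := by
  intro u hu
  rw [mem_edgeLink] at hu ⊢
  exact ⟨h hu.1, h hu.2.1, hu.2.2⟩

lemma Shatters.notMem_deletion (h : (deletion x 𝒜).Shatters X) : x ∉ X := by
  obtain ⟨u, hu, hX⟩ := h.exists_superset
  exact fun hx => notMem_of_mem_deletion hu (hX hx)

lemma Shatters.notMem_edgeLink (h : (edgeLink x 𝒜).Shatters X) : x ∉ X := by
  obtain ⟨u, hu, hX⟩ := h.exists_superset
  exact fun hx => notMem_of_mem_edgeLink hu (hX hx)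

lemma Shatters.of_deletion (h : (deletion x 𝒜).Shatters X) : 𝒜.Shatters X := by
  intro t ht
  obtain ⟨u, hu, rfl⟩ := h ht
  obtain ⟨v, hv, rfl⟩ := exists_of_mem_deletion hu
  refine ⟨v, hv, ?_⟩
  have := h.notMem_deletion
  ext i
  grind

lemma Shatters.insert_of_edgeLink (h : (edgeLink x 𝒜).Shatters X) : 𝒜.Shatters (insert x X) := by
  have hx := h.notMem_edgeLink
  intro t ht
  obtain ⟨u, hu, hut⟩ := h (t := t.erase x) (by grind)
  obtain ⟨h₁, h₂, h₃⟩ := mem_edgeLink.1 hu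
  by_cases hxt : x ∈ t
  · exact ⟨_, h₁, by rw [← insert_inter_distrib, hut, insert_erase hxt]⟩
  · exact ⟨_, h₂, by rw [insert_inter_of_notMem h₃, hut, erase_eq_of_notMem hxt]⟩

lemma HasCubeAt.shatters (h : 𝒜.HasCubeAt X v) : 𝒜.Shatters X := by
  intro t ht
  refine ⟨(v \ X) ∪ t, h _ (by grind), by grind⟩

omit [DecidableEq α] in
lemma HasCubeAt.mem (h : 𝒜.HasCubeAt X v) : v ∈ 𝒜 := h v fun _ _ => Iff.rfl

lemma HasCubeAt.deletion (h : 𝒜.HasCubeAt X v) (hx : x ∉ X) :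
    (deletion x 𝒜).HasCubeAt X (v.erase x) := by
  intro w hw
  have hxw : x ∉ w := by simp [hw x hx]
  by_cases hxv : x ∈ v
  · have : w = (insert x w).erase x := (erase_insert hxw).symm
    rw [this, erase_mem_deletion]
    exact .inl (h _ (by grind))
  · have : w = w.erase x := (erase_eq_of_notMem hxw).symm
    rw [this, erase_mem_deletion]
    exact .inl (h _ (by grind))

lemma mem_symmDiff_singleton_iff {i : α} :
    i ∈ symmDiff v {x} ↔ (i ≠ x ∧ i ∈ v ∨ i = x ∧ x ∉ v) := by
  rw [mem_symmDiff, mem_singleton]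
  grind

lemma hasCubeAt_edgeLink (hx : x ∉ X) :
    (edgeLink x 𝒜).HasCubeAt X (v.erase x) ↔ 𝒜.HasCubeAt (insert x X) v := by
  constructor
  · intro h w hw
    exact (erase_mem_edgeLink.1 (h (w.erase x) (by grind))).1
  · intro h w hw
    have hxw : x ∉ w := by simp [hw x hx]
    rw [← erase_eq_of_notMem hxw, erase_mem_edgeLink]
    refine ⟨h _ (by grind), h _ ?_⟩
    intro i hi
    rw [mem_symmDiff_singleton_iff]
    grind

lemma HasCubeAt.symmDiff (h : 𝒜.HasCubeAt X v) (hx : x ∈ X) :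
    𝒜.HasCubeAt X (symmDiff v {x}) := by
  intro w hw
  refine h w fun i hi => ?_
  rw [hw i hi, mem_symmDiff_singleton_iff]
  grind

/-- Two parallel cubes whose anchors differ at `y` shatter one more coordinate. -/
lemma HasCubeAt.shatters_insert (hv : 𝒜.HasCubeAt X v) (hw : 𝒜.HasCubeAt X w) {y : α}
    (hyv : y ∈ v) (hyw : y ∉ w) : 𝒜.Shatters (insert y X) := by
  intro t ht
  by_cases hy : y ∈ X
  · rw [insert_eq_of_mem hy] at ht ⊢
    exact hv.shatters ht
  by_cases hyt : y ∈ t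
  · exact ⟨(v \ X) ∪ t, hv _ (by grind), by grind⟩
  · exact ⟨(w \ X) ∪ t, hw _ (by grind), by grind⟩

lemma IsExtremal.deletion (h : C.IsExtremal) : (deletion x C).IsExtremal := by
  intro I hI
  obtain ⟨v, hv⟩ := h I hI.of_deletion
  exact ⟨_, hv.deletion hI.notMem_deletion⟩

lemma IsExtremal.edgeLink (h : C.IsExtremal) : (edgeLink x C).IsExtremal := by
  intro I hI
  obtain ⟨v, hv⟩ := h _ hI.insert_of_edgeLink
  exact ⟨_, (hasCubeAt_edgeLink hI.notMem_edgeLink).2 hv⟩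

lemma card_le_of_forall_shatters (hS : ∀ v ∈ 𝒜, v ⊆ S) (hd : ∀ I, 𝒜.Shatters I → #I < d) :
    #𝒜 ≤ ∑ i ∈ range d, (#S).choose i := by
  refine (card_le_card_shatterer 𝒜).trans ?_
  simp_rw [← card_powersetCard]
  refine (card_le_card fun I hI => ?_).trans card_biUnion_le
  rw [mem_shatterer] at hI
  obtain ⟨u, hu, hIu⟩ := hI.exists_superset
  exact mem_biUnion.2 ⟨#I, mem_range.2 (hd I hI), mem_powersetCard.2 ⟨hIu.trans (hS u hu), rfl⟩⟩

lemma subset_erase_of_mem_deletion (hS : ∀ v ∈ 𝒜, v ⊆ S) :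
    ∀ u ∈ deletion x 𝒜, u ⊆ S.erase x := by
  intro u hu
  obtain ⟨v, hv, rfl⟩ := exists_of_mem_deletion hu
  exact erase_subset_erase x (hS v hv)

lemma card_lt_of_shatters_edgeLink (hd : ∀ I, 𝒜.Shatters I → #I < d + 1) :
    ∀ I, (edgeLink x 𝒜).Shatters I → #I < d := by
  intro I hI
  have := hd _ hI.insert_of_edgeLink
  rw [card_insert_of_notMem hI.notMem_edgeLink] at this
  omega

lemma sum_range_succ_choose_succ (m d : ℕ) :
    ∑ i ∈ range (d + 1), (m + 1).choose i =
      ∑ i ∈ range (d + 1), m.choose i + ∑ i ∈ range d, m.choose i := by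
  rw [sum_range_succ', sum_range_succ' (fun i => m.choose i)]
  simp only [Nat.choose_succ_succ', sum_add_distrib, Nat.choose_zero_right]
  omega

lemma IsMaximum.card_deletion_and_edgeLink (h : IsMaximum S (d + 1) D) (hx : x ∈ S) :
    #(deletion x D) = ∑ i ∈ range (d + 1), (#(S.erase x)).choose i ∧
      #(edgeLink x D) = ∑ i ∈ range d, (#(S.erase x)).choose i := by
  have h₁ := card_le_of_forall_shatters (subset_erase_of_mem_deletion (x := x) h.subset)
    fun I hI => h.card_lt I hI.of_deletion
  have h₂ := card_le_of_forall_shatters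
    (fun u hu => subset_erase_of_mem_deletion (x := x) h.subset u (edgeLink_subset_deletion hu))
    (card_lt_of_shatters_edgeLink h.card_lt)
  have h₃ := card_deletion_add_card_edgeLink x D
  rw [h.card_eq, ← card_erase_add_one hx, sum_range_succ_choose_succ] at h₃
  omega

lemma IsMaximum.deletion (h : IsMaximum S (d + 1) D) (hx : x ∈ S) :
    IsMaximum (S.erase x) (d + 1) (deletion x D) where
  subset := subset_erase_of_mem_deletion h.subset
  card_lt I hI := h.card_lt I hI.of_deletion
  card_eq := (h.card_deletion_and_edgeLink hx).1

lemma IsMaximum.edgeLink (h : IsMaximum S (d + 1) D) (hx : x ∈ S) :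
    IsMaximum (S.erase x) d (edgeLink x D) where
  subset u hu := subset_erase_of_mem_deletion h.subset u (edgeLink_subset_deletion hu)
  card_lt := card_lt_of_shatters_edgeLink h.card_lt
  card_eq := (h.card_deletion_and_edgeLink hx).2

lemma IsMaximum.eq_empty (h : IsMaximum S 0 D) : D = ∅ := by
  simpa using h.card_eq

lemma IsMaximum.nonempty (h : IsMaximum S (d + 1) D) : D.Nonempty := by
  rw [← card_pos, h.card_eq, sum_range_succ']
  simp

lemma IsMaximum.exists_hasCubeAt (h : IsMaximum S d D) (hX : X ⊆ S) (hXd : #X < d) :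
    ∃ v, D.HasCubeAt X v := by
  induction X using Finset.induction_on generalizing S d D with
  | empty =>
    obtain ⟨d, rfl⟩ := Nat.exists_eq_add_one_of_ne_zero (Nat.ne_zero_of_lt hXd)
    obtain ⟨v, hv⟩ := h.nonempty
    refine ⟨v, fun w hw => ?_⟩
    rwa [show w = v by ext i; exact hw i (notMem_empty i)]
  | insert x X hx ih =>
    obtain ⟨d, rfl⟩ := Nat.exists_eq_add_one_of_ne_zero (Nat.ne_zero_of_lt hXd)
    rw [card_insert_of_notMem hx] at hXd
    obtain ⟨v, hv⟩ := ih (h.edgeLink (hX (mem_insert_self x X))) (by grind) (by omega)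
    have hxv : x ∉ v := notMem_of_mem_edgeLink hv.mem
    rw [← erase_eq_of_notMem hxv, hasCubeAt_edgeLink hx] at hv
    exact ⟨v, hv⟩

lemma IsMaximum.isExtremal (h : IsMaximum S d D) : D.IsExtremal := by
  intro I hI
  obtain ⟨u, hu, hIu⟩ := hI.exists_superset
  exact h.exists_hasCubeAt (hIu.trans (h.subset u hu)) (h.card_lt I hI)

/-- A maximum class of VC dimension `d - 1` misses at most one pattern on a `d`-set. -/
lemma IsMaximum.missed_unique (h : IsMaximum S d D) (hX : X ⊆ S) (hXd : #X = d)
    (hv : ∀ u ∈ D, ∃ i ∈ X, ¬ (i ∈ u ↔ i ∈ v)) (hw : ∀ u ∈ D, ∃ i ∈ X, ¬ (i ∈ u ↔ i ∈ w)) :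
    X ∩ v = X ∩ w := by
  induction S using Finset.strongInduction generalizing D with
  | H S ih =>
    rcases d with _ | d
    · simp [card_eq_zero.1 hXd]
    by_cases hSX : S ⊆ X
    · obtain rfl : X = S := hX.antisymm hSX
      by_contra hne
      have hsub : D ⊆ (X.powerset.erase (X ∩ v)).erase (X ∩ w) := by
        intro u hu
        simp only [mem_erase, mem_powerset]
        refine ⟨?_, ?_, h.subset u hu⟩
        · rintro rfl
          obtain ⟨i, hi, hi'⟩ := hw _ hu
          grind
        · rintro rfl
          obtain ⟨i, hi, hi'⟩ := hv _ hu
          grind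
      have hc := card_le_card hsub
      rw [card_erase_of_mem (by grind), card_erase_of_mem (by simp), card_powerset, h.card_eq]
        at hc
      have := Nat.sum_range_choose (#X)
      rw [sum_range_succ, hXd] at this
      rw [hXd] at hc
      simp only [Nat.choose_self] at this
      have : 2 ≤ 2 ^ (d + 1) := by rw [pow_succ]; have := Nat.one_le_two_pow (n := d); omega
      omega
    · obtain ⟨x, hxS, hxX⟩ := not_subset.1 hSX
      refine ih (S.erase x) (erase_ssubset hxS) (h.deletion hxS) (by grind) ?_ ?_
      · intro u hu
        obtain ⟨u, hu', rfl⟩ := exists_of_mem_deletion hu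
        obtain ⟨i, hi, hi'⟩ := hv u hu'
        exact ⟨i, hi, by grind⟩
      · intro u hu
        obtain ⟨u, hu', rfl⟩ := exists_of_mem_deletion hu
        obtain ⟨i, hi, hi'⟩ := hw u hu'
        exact ⟨i, hi, by grind⟩

lemma IsLabel.subset (h : IsLabel C D d X v) (hS : ∀ u ∈ C, u ⊆ S) : X ⊆ S := by
  obtain ⟨u, hu, hXu⟩ := h.cube.shatters.exists_superset
  exact hXu.trans (hS u hu)

omit [DecidableEq α] in
lemma IsLabel.notMem (h : IsLabel C D d X v) : v ∉ D := by
  intro hv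
  obtain ⟨i, -, hi⟩ := h.missed v hv
  exact hi Iff.rfl

/-- A set labels at most one vertex. -/
lemma IsLabel.vertex_unique (hS : ∀ u ∈ C, u ⊆ S) (hVC : ∀ I, C.Shatters I → #I ≤ d)
    (hD : IsMaximum S d D) (hv : IsLabel C D d X v) (hw : IsLabel C D d X w) : v = w := by
  have hX := hD.missed_unique (hv.subset hS) hv.card_eq hv.missed hw.missed
  ext i
  by_cases hi : i ∈ X
  · have := congrArg (i ∈ ·) hX
    simpa [hi] using this
  · have hc := hv.card_eq
    have key {v w : Finset α} (hv : C.HasCubeAt X v) (hw : C.HasCubeAt X w) (hiv : i ∈ v) :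
        i ∈ w := by
      by_contra hiw
      have := hVC _ (hv.shatters_insert hw hiv hiw)
      rw [card_insert_of_notMem hi] at this
      omega
    exact ⟨key hv.cube hw.cube, key hw.cube hv.cube⟩

lemma isLabel_deletion (hC : C.IsExtremal) (hVC : ∀ I, C.Shatters I → #I ≤ d) :
    IsLabel (deletion x C) (deletion x D) d X (v.erase x) ↔
      x ∉ X ∧ (IsLabel C D d X v ∨ IsLabel C D d X (symmDiff v {x})) := by
  have herase : (symmDiff v {x}).erase x = v.erase x := by
    ext i; rw [mem_erase, mem_symmDiff_singleton_iff, mem_erase]; tauto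
  constructor
  · intro h
    have hx := h.cube.shatters.notMem_deletion
    refine ⟨hx, ?_⟩
    have hmiss {w : Finset α} (hw : w.erase x = v.erase x) :
        ∀ u ∈ D, ∃ i ∈ X, ¬ (i ∈ u ↔ i ∈ w) := by
      intro u hu
      obtain ⟨i, hi, hi'⟩ := h.missed _ (erase_mem_deletion.2 (.inl hu))
      rw [← hw] at hi'
      exact ⟨i, hi, by grind⟩
    obtain ⟨w, hw⟩ := hC X h.cube.shatters.of_deletion
    have heq : ∀ i, i ∉ X → (i ∈ w.erase x ↔ i ∈ v.erase x) := by
      intro i hi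
      have key {v w : Finset α} (hv : (deletion x C).HasCubeAt X v)
          (hw : (deletion x C).HasCubeAt X w) (hiv : i ∈ v) : i ∈ w := by
        by_contra hiw
        have := hVC _ (hv.shatters_insert hw hiv hiw).of_deletion
        rw [card_insert_of_notMem hi, h.card_eq] at this
        omega
      exact ⟨key (hw.deletion hx) h.cube, key h.cube (hw.deletion hx)⟩
    by_cases hxvw : x ∈ v ↔ x ∈ w
    · refine .inl ⟨h.card_eq, fun u hu => hw u fun i hi => ?_, hmiss rfl⟩
      have := heq i hi
      rw [hu i hi]
      by_cases hix : i = x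
      · rw [hix, hxvw]
      · grind
    · refine .inr ⟨h.card_eq, fun u hu => hw u fun i hi => ?_, hmiss herase⟩
      have := heq i hi
      rw [hu i hi, mem_symmDiff_singleton_iff]
      by_cases hix : i = x
      · grind
      · grind
  · rintro ⟨hx, h⟩
    have key {w : Finset α} (h : IsLabel C D d X w) :
        IsLabel (deletion x C) (deletion x D) d X (w.erase x) := by
      refine ⟨h.card_eq, h.cube.deletion hx, fun u hu => ?_⟩
      obtain ⟨u, hu', rfl⟩ := exists_of_mem_deletion hu
      obtain ⟨i, hi, hi'⟩ := h.missed u hu'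
      exact ⟨i, hi, by grind⟩
    rcases h with h | h
    · exact key h
    · exact herase ▸ key h

lemma isLabel_edgeLink (hS : ∀ u ∈ C, u ⊆ S) (hx : x ∈ S) (hD : IsMaximum S (d + 1) D) :
    IsLabel (edgeLink x C) (edgeLink x D) d Y (v.erase x) ↔
      x ∉ Y ∧ (IsLabel C D (d + 1) (insert x Y) v ∨
        IsLabel C D (d + 1) (insert x Y) (symmDiff v {x})) := by
  have herase : (symmDiff v {x}).erase x = v.erase x := by
    ext i; rw [mem_erase, mem_symmDiff_singleton_iff, mem_erase]; tauto
  constructor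
  · intro h
    have hxY := h.cube.shatters.notMem_edgeLink
    have hcard : #(insert x Y) = d + 1 := by rw [card_insert_of_notMem hxY, h.card_eq]
    have hcube := (hasCubeAt_edgeLink hxY).1 h.cube
    refine ⟨hxY, ?_⟩
    have hns : ¬ D.Shatters (insert x Y) := fun hs => by
      have := hD.card_lt _ hs
      omega
    obtain ⟨P, hP, hPu⟩ : ∃ P ⊆ insert x Y, ∀ u ∈ D, insert x Y ∩ u ≠ P := by
      simpa [Shatters] using hns
    have hmiss : ∀ u ∈ D, ∃ i ∈ insert x Y, ¬ (i ∈ u ↔ i ∈ P) := by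
      intro u hu
      by_contra! hcon
      refine hPu u hu ?_
      ext i
      have := hcon i
      grind
    have hYS : Y ⊆ S.erase x := by
      obtain ⟨u, hu, hYu⟩ := h.cube.shatters.exists_superset
      exact hYu.trans (subset_erase_of_mem_deletion hS u (edgeLink_subset_deletion hu))
    have hYP : Y ∩ P = Y ∩ v.erase x := by
      refine (hD.edgeLink hx).missed_unique hYS h.card_eq ?_ h.missed
      intro u hu
      obtain ⟨h₁, h₂, h₃⟩ := mem_edgeLink.1 hu
      by_cases hxP : x ∈ P
      · obtain ⟨i, hi, hi'⟩ := hmiss _ h₁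
        exact ⟨i, by grind, by grind⟩
      · obtain ⟨i, hi, hi'⟩ := hmiss _ h₂
        exact ⟨i, by grind, by grind⟩
    have hYP' : ∀ i ∈ Y, (i ∈ P ↔ i ∈ v.erase x) := by
      intro i hi
      have := congrArg (i ∈ ·) hYP
      simpa [hi] using this
    by_cases hxvP : x ∈ v ↔ x ∈ P
    · refine .inl ⟨hcard, hcube, fun u hu => ?_⟩
      obtain ⟨i, hi, hi'⟩ := hmiss u hu
      refine ⟨i, hi, ?_⟩
      grind
    · refine .inr ⟨hcard, hcube.symmDiff (mem_insert_self x Y), fun u hu => ?_⟩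
      obtain ⟨i, hi, hi'⟩ := hmiss u hu
      refine ⟨i, hi, ?_⟩
      rw [mem_symmDiff_singleton_iff]
      grind
  · rintro ⟨hxY, h⟩
    have key {w : Finset α} (h : IsLabel C D (d + 1) (insert x Y) w) :
        IsLabel (edgeLink x C) (edgeLink x D) d Y (w.erase x) := by
      have hc := h.card_eq
      rw [card_insert_of_notMem hxY] at hc
      refine ⟨by omega, (hasCubeAt_edgeLink hxY).2 h.cube, fun u hu => ?_⟩
      obtain ⟨h₁, h₂, h₃⟩ := mem_edgeLink.1 hu
      by_cases hxw : x ∈ w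
      · obtain ⟨i, hi, hi'⟩ := h.missed _ h₁
        exact ⟨i, by grind, by grind⟩
      · obtain ⟨i, hi, hi'⟩ := h.missed _ h₂
        exact ⟨i, by grind, by grind⟩
    rcases h with h | h
    · exact key h
    · exact herase ▸ key h

/-- If the vertex `v` of `C \ D` has no unique label, then so do all its neighbours, provided
labels are unique in the deletion and in the link. -/
lemma symmDiff_not_existsUnique_isLabel (hS : ∀ u ∈ C, u ⊆ S) (hC : C.IsExtremal)
    (hVC : ∀ I, C.Shatters I → #I ≤ d + 1) (hD : IsMaximum S (d + 1) D) (hDC : D ⊆ C)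
    (hx : x ∈ S)
    (hdel : ∀ u ∈ deletion x C, u ∉ deletion x D →
      ∃! X, IsLabel (deletion x C) (deletion x D) (d + 1) X u)
    (hlink : ∀ u ∈ edgeLink x C, u ∉ edgeLink x D →
      ∃! X, IsLabel (edgeLink x C) (edgeLink x D) d X u)
    (hvC : v ∈ C) (hvD : v ∉ D) (hv : ¬ ∃! X, IsLabel C D (d + 1) X v) :
    (symmDiff v {x} ∈ C ∧ symmDiff v {x} ∉ D) ∧
      ¬ ∃! X, IsLabel C D (d + 1) X (symmDiff v {x}) := by
  set w := symmDiff v {x} with hw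
  have hdel' : w ∉ D → ∃! X, x ∉ X ∧ (IsLabel C D (d + 1) X v ∨ IsLabel C D (d + 1) X w) := by
    intro hwD
    simpa only [isLabel_deletion hC hVC] using
      hdel (v.erase x) (erase_mem_deletion.2 (.inl hvC)) (by rw [erase_mem_deletion]; tauto)
  have hlink' : w ∈ C →
      ∃! X, x ∈ X ∧ (IsLabel C D (d + 1) X v ∨ IsLabel C D (d + 1) X w) := by
    intro hwC
    obtain ⟨Y, hY, hYu⟩ := hlink (v.erase x) (erase_mem_edgeLink.2 ⟨hvC, hwC⟩)
      (by rw [erase_mem_edgeLink]; tauto)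
    simp only [isLabel_edgeLink hS hx hD] at hY hYu
    refine ⟨insert x Y, ⟨mem_insert_self x Y, hY.2⟩, ?_⟩
    rintro X ⟨hxX, hX⟩
    rw [← hYu (X.erase x) ⟨notMem_erase x X, by rwa [insert_erase hxX]⟩, insert_erase hxX]
  have hexcl : ∀ X, IsLabel C D (d + 1) X v → IsLabel C D (d + 1) X w → False := by
    intro X h₁ h₂
    have := congrArg (x ∈ ·) (h₁.vertex_unique hS hVC hD h₂)
    simp only [hw, mem_symmDiff_singleton_iff] at this
    grind
  have hwC : w ∈ C := by
    by_contra hwC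
    obtain ⟨X, ⟨hxX, hX⟩, hXu⟩ := hdel' fun h => hwC (hDC h)
    have hX : IsLabel C D (d + 1) X v := hX.resolve_right fun h => hwC h.cube.mem
    refine hv ⟨X, hX, fun X' hX' => hXu X' ⟨fun hx' => hwC ?_, .inl hX'⟩⟩
    exact (hX'.cube.symmDiff hx').mem
  obtain ⟨X₁, ⟨hx₁, h₁⟩, hu₁⟩ := hlink' hwC
  have hwD : w ∉ D := by
    intro hwD
    have h₁ : IsLabel C D (d + 1) X₁ v := h₁.resolve_right fun h => h.notMem hwD
    refine hv ⟨X₁, h₁, fun X' hX' => hu₁ X' ⟨?_, .inl hX'⟩⟩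
    by_contra hxX'
    obtain ⟨i, hi, hi'⟩ := hX'.missed w hwD
    rw [hw, mem_symmDiff_singleton_iff] at hi'
    grind
  refine ⟨⟨hwC, hwD⟩, fun ⟨X, hX, hXu⟩ => hv ?_⟩
  obtain ⟨X₀, ⟨hx₀, h₀⟩, hu₀⟩ := hdel' hwD
  have hne : X₀ ≠ X₁ := fun h => hx₀ (h ▸ hx₁)
  have hX' : X = X₀ ∨ X = X₁ := by
    by_cases hxX : x ∈ X
    · exact .inr (hu₁ X ⟨hxX, .inr hX⟩)
    · exact .inl (hu₀ X ⟨hxX, .inr hX⟩)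
  have hcases : ∀ Z, IsLabel C D (d + 1) Z v → Z = X₀ ∨ Z = X₁ := by
    intro Z hZ
    by_cases hxZ : x ∈ Z
    · exact .inr (hu₁ Z ⟨hxZ, .inl hZ⟩)
    · exact .inl (hu₀ Z ⟨hxZ, .inl hZ⟩)
  rcases hX' with rfl | rfl
  · have h₁ : IsLabel C D (d + 1) X₁ v := h₁.resolve_right fun h => hne (hXu X₁ h).symm
    refine ⟨X₁, h₁, fun Z hZ => (hcases Z hZ).resolve_left ?_⟩
    rintro rfl
    exact hexcl _ hZ hX
  · have h₀ : IsLabel C D (d + 1) X₀ v := h₀.resolve_right fun h => hne (hXu X₀ h)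
    refine ⟨X₀, h₀, fun Z hZ => (hcases Z hZ).resolve_right ?_⟩
    rintro rfl
    exact hexcl _ hZ hX

/-- A property of vertices that spreads along all edges of the cube holds everywhere. -/
lemma forall_subset_of_symmDiff {p : Finset α → Prop} (hp : ∀ x ∈ S, ∀ u, p u → p (symmDiff u {x}))
    (hv : p v) (hvS : v ⊆ S) (hwS : w ⊆ S) : p w := by
  have key : ∀ t ⊆ S, p (symmDiff v t) := by
    intro t ht
    induction t using Finset.induction_on with
    | empty => rwa [show symmDiff v ∅ = v from symmDiff_bot v]
    | insert x t hx ih =>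
      have := hp x (ht (mem_insert_self x t)) _ (ih ((subset_insert x t).trans ht))
      rwa [symmDiff_assoc, show symmDiff t {x} = insert x t by
        ext i; rw [mem_symmDiff_singleton_iff]; grind] at this
  have := key (symmDiff v w) (by grind [mem_symmDiff])
  rwa [symmDiff_symmDiff_cancel_left] at this

/-- Every vertex of `C \ D` has a unique label. -/
lemma existsUnique_isLabel (hS : ∀ u ∈ C, u ⊆ S) (hC : C.IsExtremal)
    (hVC : ∀ I, C.Shatters I → #I ≤ d) (hD : IsMaximum S d D) (hDC : D ⊆ C)
    (hvC : v ∈ C) (hvD : v ∉ D) : ∃! X, IsLabel C D d X v := by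
  induction S using Finset.strongInduction generalizing C D d v with
  | H S ih =>
    rcases d with _ | d
    · refine ⟨∅, ⟨rfl, fun w hw => ?_, ?_⟩, fun X hX => card_eq_zero.1 hX.card_eq⟩
      · rwa [show w = v by ext i; exact hw i (notMem_empty i)]
      · simp [hD.eq_empty]
    by_contra hv
    obtain ⟨u, hu⟩ := hD.nonempty
    refine (forall_subset_of_symmDiff (S := S) (w := u) (p := fun w => (w ∈ C ∧ w ∉ D) ∧
      ¬ ∃! X, IsLabel C D (d + 1) X w) (fun x hx w hw => ?_) ⟨⟨hvC, hvD⟩, hv⟩ (hS v hvC)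
      (hD.subset u hu)).1.2 hu
    refine symmDiff_not_existsUnique_isLabel hS hC hVC hD hDC hx (fun z hz hz' => ?_)
      (fun z hz hz' => ?_) hw.1.1 hw.1.2 hw.2
    · exact ih _ (erase_ssubset hx) (subset_erase_of_mem_deletion hS) hC.deletion
        (fun I hI => hVC I hI.of_deletion) (hD.deletion hx) (deletion_mono hDC) hz hz'
    · refine ih _ (erase_ssubset hx)
        (fun u hu => subset_erase_of_mem_deletion hS u (edgeLink_subset_deletion hu)) hC.edgeLink
        (fun I hI => ?_) (hD.edgeLink hx) (edgeLink_mono hDC) hz hz'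
      have := card_lt_of_shatters_edgeLink (d := d + 1)
        (fun I hI => Nat.lt_succ_of_le (hVC I hI)) I hI
      omega

/-- Vertices agreeing on both of their labels coincide. -/
lemma IsLabel.eq_of_agree (hS : ∀ u ∈ C, u ⊆ S) (hC : C.IsExtremal)
    (hVC : ∀ I, C.Shatters I → #I ≤ d) (hD : IsMaximum S d D) (hDC : D ⊆ C)
    (hv : IsLabel C D d X v) (hw : IsLabel C D d Y w)
    (h : ∀ i ∈ X ∪ Y, (i ∈ v ↔ i ∈ w)) : v = w := by
  induction S using Finset.strongInduction generalizing C D v w with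
  | H S ih =>
    by_contra hne
    obtain ⟨x, hx⟩ : ∃ x, ¬ (x ∈ v ↔ x ∈ w) := by
      by_contra! hcon
      exact hne (ext hcon)
    have hxXY : x ∉ X ∪ Y := fun hxXY => hx (h x hxXY)
    have hxX : x ∉ X := by grind
    have hxY : x ∉ Y := by grind
    have hxS : x ∈ S := by
      have := hS v hv.cube.mem
      have := hS w hw.cube.mem
      grind
    rcases d with _ | d
    · obtain rfl : X = Y := by rw [card_eq_zero.1 hv.card_eq, card_eq_zero.1 hw.card_eq]
      exact hne (hv.vertex_unique hS hVC hD hw)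
    have hv' := (isLabel_deletion (D := D) (v := v) (x := x) hC hVC).2 ⟨hxX, .inl hv⟩
    have hw' := (isLabel_deletion (D := D) (v := w) (x := x) hC hVC).2 ⟨hxY, .inl hw⟩
    have hS' := subset_erase_of_mem_deletion (x := x) hS
    have hVC' : ∀ I, (Finset.deletion x C).Shatters I → #I ≤ d + 1 :=
      fun I hI => hVC I hI.of_deletion
    have heq : v.erase x = w.erase x :=
      ih _ (erase_ssubset hxS) hS' hC.deletion hVC' (hD.deletion hxS) (deletion_mono hDC) hv' hw'
        (by grind)
    rw [← heq] at hw'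
    obtain rfl : X = Y := (existsUnique_isLabel hS' hC.deletion hVC' (hD.deletion hxS)
      (deletion_mono hDC) hv'.cube.mem hv'.notMem).unique hv' hw'
    exact hne (hv.vertex_unique hS hVC hD hw)

/-- `r` is an unlabelled compression scheme for `𝒜` with sets inside `S`. -/
structure IsScheme (S : Finset α) (𝒜 : Finset (Finset α)) (r : Finset α → Finset α) : Prop where
  subset : ∀ v ∈ 𝒜, r v ⊆ S
  injective : ∀ v ∈ 𝒜, ∀ w ∈ 𝒜, r v = r w → v = w
  eq_of_agree : ∀ v ∈ 𝒜, ∀ w ∈ 𝒜, (∀ i ∈ r v ∪ r w, (i ∈ v ↔ i ∈ w)) → v = w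

variable {r : Finset α → Finset α}

/-- A scheme for a maximum subclass extends to the whole extremal class. -/
lemma IsScheme.exists_extension (hS : ∀ u ∈ C, u ⊆ S) (hC : C.IsExtremal)
    (hVC : ∀ I, C.Shatters I → #I ≤ d) (hD : IsMaximum S d D) (hDC : D ⊆ C)
    (hr : IsScheme S D r) (hrd : ∀ v ∈ D, #(r v) < d) :
    ∃ r', IsScheme S C r' ∧ (∀ v ∈ C, #(r' v) ≤ d) ∧ ∀ v ∈ D, r' v = r v := by
  have hlabel : ∀ v, ∃ X, v ∈ C → v ∉ D → IsLabel C D d X v := by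
    intro v
    by_cases h : v ∈ C ∧ v ∉ D
    · obtain ⟨X, hX, -⟩ := existsUnique_isLabel hS hC hVC hD hDC h.1 h.2
      exact ⟨X, fun _ _ => hX⟩
    · exact ⟨∅, by tauto⟩
  choose f hf using hlabel
  have hin : ∀ v ∈ D, (if v ∈ D then r v else f v) = r v := fun v hv => if_pos hv
  have hout : ∀ v, v ∉ D → (if v ∈ D then r v else f v) = f v := fun v hv => if_neg hv
  refine ⟨fun v => if v ∈ D then r v else f v, ⟨fun v hv => ?_, fun v hv w hw h => ?_,
    fun v hv w hw h => ?_⟩, fun v hv => ?_, hin⟩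
  · by_cases hvD : v ∈ D
    · simpa only [hin v hvD] using hr.subset v hvD
    · simpa only [hout v hvD] using (hf v hv hvD).subset hS
  · by_cases hvD : v ∈ D <;> by_cases hwD : w ∈ D
    · simp only [hin v hvD, hin w hwD] at h
      exact hr.injective v hvD w hwD h
    · simp only [hin v hvD, hout w hwD] at h
      exact absurd (h ▸ hrd v hvD) (by simp [(hf w hw hwD).card_eq])
    · simp only [hout v hvD, hin w hwD] at h
      exact absurd (h ▸ hrd w hwD) (by simp [(hf v hv hvD).card_eq])
    · simp only [hout v hvD, hout w hwD] at h
      exact (hf v hv hvD).vertex_unique hS hVC hD (h ▸ hf w hw hwD)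
  · by_cases hvD : v ∈ D <;> by_cases hwD : w ∈ D
    · simp only [hin v hvD, hin w hwD] at h
      exact hr.eq_of_agree v hvD w hwD h
    · simp only [hout w hwD] at h
      obtain ⟨i, hi, hi'⟩ := (hf w hw hwD).missed v hvD
      exact absurd (h i (mem_union_right _ hi)) hi'
    · simp only [hout v hvD] at h
      obtain ⟨i, hi, hi'⟩ := (hf v hv hvD).missed w hwD
      exact absurd (h i (mem_union_left _ hi)).symm hi'
    · simp only [hout v hvD, hout w hwD] at h
      exact (hf v hv hvD).eq_of_agree hS hC hVC hD hDC (hf w hw hwD) h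
  · by_cases hvD : v ∈ D
    · simpa only [hin v hvD] using (hrd v hvD).le
    · simpa only [hout v hvD] using (hf v hv hvD).card_eq.le

/-- Maximum classes have schemes of size their VC dimension. -/
lemma IsMaximum.exists_isScheme (hD : IsMaximum S d D) :
    ∃ r, IsScheme S D r ∧ ∀ v ∈ D, #(r v) < d := by
  induction S using Finset.induction_on generalizing d D with
  | empty =>
    have hv : ∀ v ∈ D, v = ∅ := fun v hv => subset_empty.1 (hD.subset v hv)
    refine ⟨fun _ => ∅, ⟨fun _ _ => Subset.rfl, fun v h w h' _ => by rw [hv v h, hv w h'],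
      fun v h w h' _ => by rw [hv v h, hv w h']⟩, fun v h => ?_⟩
    exact hD.card_lt ∅ (shatters_empty.2 ⟨v, h⟩)
  | insert x S hx ih =>
    rcases d with _ | d
    · obtain rfl := hD.eq_empty
      exact ⟨id, ⟨by simp, by simp, by simp⟩, by simp⟩
    have hdel := hD.deletion (mem_insert_self x S)
    have hlink := hD.edgeLink (mem_insert_self x S)
    rw [erase_insert hx] at hdel hlink
    obtain ⟨r₀, hr₀, hr₀d⟩ := ih hlink
    obtain ⟨r, hr, hrd, hrr⟩ := hr₀.exists_extension hdel.subset hdel.isExtremal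
      (fun I hI => Nat.le_of_lt_succ (hdel.card_lt I hI)) hlink edgeLink_subset_deletion hr₀d
    have hmem : ∀ v ∈ D, v.erase x ∈ Finset.deletion x D :=
      fun v hv => erase_mem_deletion.2 (.inl hv)
    have hxr : ∀ v ∈ D, x ∉ r (v.erase x) := fun v hv h => hx (hr.subset _ (hmem v hv) h)
    have hsep : ∀ v ∈ D, ∀ w ∈ D, v.erase x = w.erase x → x ∈ v → x ∉ w →
        v.erase x ∈ Finset.edgeLink x D := by
      intro v hv w hw h hxv hxw
      rw [mem_edgeLink, insert_erase hxv, h, erase_eq_of_notMem hxw]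
      exact ⟨hv, hw, hxw⟩
    have hext : ∀ v w : Finset α, v.erase x = w.erase x → (x ∈ v ↔ x ∈ w) → v = w := by
      intro v w h hxvw
      ext i
      have := congrArg (i ∈ ·) h
      by_cases hix : i = x
      · rw [hix, hxvw]
      · simpa [hix] using this
    refine ⟨fun v => if x ∈ v ∧ v.erase x ∈ Finset.edgeLink x D then insert x (r (v.erase x))
      else r (v.erase x), ⟨fun v hv => ?_, fun v hv w hw h => ?_, fun v hv w hw h => ?_⟩,
      fun v hv => ?_⟩
    · have := hr.subset _ (hmem v hv)
      split_ifs <;> grind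
    · have hvx := hxr v hv
      have hwx := hxr w hw
      have h₁ : r (v.erase x) = r (w.erase x) := by
        split_ifs at h
        · rw [← erase_insert hvx, h, erase_insert hwx]
        all_goals grind
      have h₂ := hr.injective _ (hmem v hv) _ (hmem w hw) h₁
      refine hext v w h₂ ?_
      have h₃ := hsep v hv w hw h₂
      have h₄ := hsep w hw v hv h₂.symm
      rw [← h₂] at h h₄
      by_contra hcon
      split_ifs at h <;> grind
    · have h₂ : v.erase x = w.erase x := by
        refine hr.eq_of_agree _ (hmem v hv) _ (hmem w hw) fun i hi => ?_
        have hix : i ≠ x := by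
          rintro rfl
          rcases mem_union.1 hi with hi | hi
          · exact hxr v hv hi
          · exact hxr w hw hi
        have := h i (by split_ifs <;> grind)
        simp [hix, this]
      refine hext v w h₂ ?_
      have h₃ := hsep v hv w hw h₂
      have h₄ := hsep w hw v hv h₂.symm
      rw [← h₂] at h h₄
      by_contra hcon
      refine hcon (h x ?_)
      split_ifs <;> grind
    · dsimp only
      split_ifs with h
      · have := hr₀d _ h.2
        rw [← hrr _ h.2] at this
        exact (card_insert_le _ _).trans_lt (by omega)
      · exact Nat.lt_succ_of_le (hrd _ (hmem v hv))

/-- An extremal class of VC dimension at most `d` containing a maximum class of VC dimension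
`d - 1` has a scheme of size `d`. -/
theorem IsExtremal.exists_isScheme (hS : ∀ u ∈ C, u ⊆ S) (hC : C.IsExtremal)
    (hVC : ∀ I, C.Shatters I → #I ≤ d) (hD : IsMaximum S d D) (hDC : D ⊆ C) :
    ∃ r, IsScheme S C r ∧ ∀ v ∈ C, #(r v) ≤ d := by
  obtain ⟨r, hr, hrd⟩ := hD.exists_isScheme
  obtain ⟨r', hr', hrd', -⟩ := hr.exists_extension hS hC hVC hD hDC hrd
  exact ⟨r', hr', hrd'⟩

end Finset

/-- The set of coordinates at which a vertex is `1`. -/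
def onesEquiv (n : ℕ) : (Fin n → Bool) ≃ Finset (Fin n) where
  toFun v := Finset.univ.filter fun i => v i = true
  invFun s i := decide (i ∈ s)
  left_inv v := by ext i; simp
  right_inv s := by ext i; simp

@[simp]
lemma mem_onesEquiv (v : Fin n → Bool) (i : Fin n) : i ∈ onesEquiv n v ↔ v i = true := by
  simp [onesEquiv]

@[simp]
lemma onesEquiv_symm_apply (s : Finset (Fin n)) (i : Fin n) :
    (onesEquiv n).symm s i = decide (i ∈ s) := rfl

/-- A class of vertices as a family of finite sets. -/
noncomputable def toFamily (C : Set (Fin n → Bool)) : Finset (Finset (Fin n)) :=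
  (Set.toFinite (onesEquiv n '' C)).toFinset

lemma onesEquiv_mem_toFamily {C : Set (Fin n → Bool)} {v : Fin n → Bool} :
    onesEquiv n v ∈ toFamily C ↔ v ∈ C := by
  simp [toFamily]

lemma mem_toFamily {C : Set (Fin n → Bool)} {s : Finset (Fin n)} :
    s ∈ toFamily C ↔ (onesEquiv n).symm s ∈ C := by
  rw [← onesEquiv_mem_toFamily, Equiv.apply_symm_apply]

lemma card_toFamily (C : Set (Fin n → Bool)) : (toFamily C).card = C.ncard := by
  rw [toFamily, ← Set.ncard_eq_toFinset_card,
    Set.ncard_image_of_injective _ (onesEquiv n).injective]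

lemma shatters_toFamily {C : Set (Fin n → Bool)} {I : Finset (Fin n)} :
    (toFamily C).Shatters I ↔ Shatters C I := by
  constructor
  · refine fun h => Set.eq_univ_of_forall fun b => ?_
    obtain ⟨u, hu, hIu⟩ := h (t := I.filter fun i => ∃ hi : i ∈ I, b ⟨i, hi⟩ = true)
      (Finset.filter_subset _ _)
    refine ⟨_, mem_toFamily.1 hu, funext fun ⟨i, hi⟩ => ?_⟩
    have := congrArg (i ∈ ·) hIu
    simp only [Finset.mem_inter, Finset.mem_filter, hi, true_and, exists_true_left,
      eq_iff_iff] at this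
    simp [proj, this]
  · intro h t ht
    obtain ⟨v, hv, hvt⟩ := h.ge (Set.mem_univ fun i => decide (i.1 ∈ t))
    refine ⟨_, onesEquiv_mem_toFamily.2 hv, ?_⟩
    ext i
    by_cases hi : i ∈ I
    · have := congrFun hvt ⟨i, hi⟩
      simp only [proj] at this
      simp [hi, this]
    · simp only [Finset.mem_inter, hi, false_and, false_iff]
      exact fun h => hi (ht h)

lemma Extremal.isExtremal_toFamily {C : Set (Fin n → Bool)} (hC : Extremal C) :
    (toFamily C).IsExtremal := by
  intro I hI
  obtain ⟨c, ⟨a, rfl⟩, hc⟩ := hC I (shatters_toFamily.1 hI)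
  refine ⟨onesEquiv n a, fun w hw => mem_toFamily.2 (hc fun i hi => ?_)⟩
  have := hw i hi
  simp [this]

lemma Shatters.card_le_VCdim {C : Set (Fin n → Bool)} {I : Finset (Fin n)} (h : Shatters C I) :
    I.card ≤ VCdim C := by
  refine le_csSup ⟨n, ?_⟩ ⟨I, rfl, h⟩
  rintro k ⟨J, rfl, -⟩
  simpa using J.card_le_univ

/-- An extremal class of VC dimension `d ≥ 1` containing a maximum
class of VC dimension `d - 1` admits an unlabelled compression scheme of size `d`. -/
theorem extremal_with_maximum_subclass_compression (C D : Set (Fin n → Bool)) (d : ℕ)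
    (hd : 1 ≤ d) (hC : Extremal C) (hVC : VCdim C = d)
    (hsub : D ⊆ C) (hVCD : VCdim D = d - 1)
    (hcard : D.ncard = ∑ i ∈ Finset.range d, Nat.choose n i) :
    HasCompression C d := by
  have hmax : Finset.IsMaximum Finset.univ d (toFamily D) :=
    { subset := fun v _ => v.subset_univ
      card_lt := fun I hI => by
        have := (shatters_toFamily.1 hI).card_le_VCdim
        omega
      card_eq := by rw [card_toFamily, hcard, Finset.card_univ, Fintype.card_fin] }
  obtain ⟨r, hr, hrd⟩ := hC.isExtremal_toFamily.exists_isScheme (fun v _ => v.subset_univ)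
    (fun I hI => hVC ▸ (shatters_toFamily.1 hI).card_le_VCdim) hmax
    (fun s hs => mem_toFamily.2 (hsub (mem_toFamily.1 hs)))
  refine ⟨fun v => r (onesEquiv n v), fun v hv w hw h => (onesEquiv n).injective
    (hr.injective _ (onesEquiv_mem_toFamily.2 hv) _ (onesEquiv_mem_toFamily.2 hw) h),
    fun v hv => hrd _ (onesEquiv_mem_toFamily.2 hv), fun v hv w hw hne => ?_⟩
  by_contra! hcon
  refine hne ((onesEquiv n).injective (hr.eq_of_agree _ (onesEquiv_mem_toFamily.2 hv) _
    (onesEquiv_mem_toFamily.2 hw) fun i hi => ?_))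
  simp [hcon i hi]
end
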